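/- arXiv:1207.3069 — 2 statements merged into one kernel-verified Lean document; each statement's English description precedes it below -/
import Mathlib

section
/- For every n ≥ 3, the group Sp(2n,ℤ) is perfect: it equals its own commutator subgroup. -/
namespace SymplecticGroup

open Matrix

section CommRing

variable {l R : Type*} [DecidableEq l] [CommRing R]

/-- The vectors whose coordinates with index in `S`, in both halves of `l ⊕ l`, vanish. -/
def supportedOff (S : Finset l) : Submodule R (l ⊕ l → R) where
  carrier := {v | ∀ p, Sum.elim id id p ∈ S → v p = 0}
  add_mem' hv hw p hp := by simp [hv p hp, hw p hp]
  zero_mem' _ _ := rfl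
  smul_mem' c v hv p hp := by simp [hv p hp]

theorem single_mem_supportedOff {S : Finset l} {p : l ⊕ l} (hp : Sum.elim id id p ∉ S) :
    (Pi.single p 1 : l ⊕ l → R) ∈ supportedOff S := fun q hq ↦
  Pi.single_eq_of_ne (by rintro rfl; exact hp hq) 1

variable [Fintype l]

variable (l R) in
/-- The standard symplectic form on `R²ˡ`, whose matrix is `J`. -/
noncomputable def form : LinearMap.BilinForm R (l ⊕ l → R) := Matrix.toBilin' (J l R)

theorem form_single_inl (i : l) (v : l ⊕ l → R) :
    form l R (Pi.single (Sum.inl i) 1) v = -v (Sum.inr i) := by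
  simp [form, Matrix.toBilin'_apply', J, Matrix.mulVec, dotProduct, Matrix.one_apply,
    Pi.single_apply]

theorem form_single_inr (i : l) (v : l ⊕ l → R) :
    form l R (Pi.single (Sum.inr i) 1) v = v (Sum.inl i) := by
  simp [form, Matrix.toBilin'_apply', J, Matrix.mulVec, dotProduct, Matrix.one_apply,
    Pi.single_apply]

theorem form_swap (v w : l ⊕ l → R) : form l R v w = -form l R w v := by
  rw [form, Matrix.toBilin'_apply', Matrix.toBilin'_apply', dotProduct_mulVec,
    ← mulVec_transpose, J_transpose, neg_mulVec, neg_dotProduct, dotProduct_comm]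

theorem form_self (v : l ⊕ l → R) : form l R v v = 0 := by
  simp [form, Matrix.toBilin'_apply', J, Matrix.mulVec, dotProduct, Matrix.one_apply, mul_comm]

theorem mem_iff_form {A : Matrix (l ⊕ l) (l ⊕ l) R} :
    A ∈ symplecticGroup l R ↔ ∀ v w, form l R (A *ᵥ v) (A *ᵥ w) = form l R v w := by
  have key : ∀ v w, form l R (A *ᵥ v) (A *ᵥ w) = Matrix.toBilin' (Aᵀ * J l R * A) v w := by
    intro v w
    rw [form, Matrix.toBilin'_apply', Matrix.toBilin'_apply', Matrix.mul_assoc,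
      ← mulVec_mulVec, ← mulVec_mulVec, dotProduct_mulVec v, vecMul_transpose]
  rw [mem_iff']
  refine ⟨fun h v w ↦ by rw [key, h, form], fun h ↦ Matrix.toBilin'.injective ?_⟩
  exact LinearMap.ext₂ fun v w ↦ (key v w).symm.trans (h v w)

theorem form_smul_smul (g : symplecticGroup l R) (v w : l ⊕ l → R) :
    form l R (g • v) (g • w) = form l R v w :=
  mem_iff_form.1 g.2 v w

theorem ext_smul {g h : symplecticGroup l R} (H : ∀ v : l ⊕ l → R, g • v = h • v) : g = h :=
  Subtype.ext (Matrix.ext_iff_smul.2 H)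

theorem ext_smul_single {g h : symplecticGroup l R}
    (H : ∀ p, g • (Pi.single p 1 : l ⊕ l → R) = h • Pi.single p 1) : g = h :=
  Subtype.ext <| Matrix.ext_of_mulVec_single H

theorem transvection_mulVec (a : R) (u v : l ⊕ l → R) :
    (1 + a • vecMulVec u (u ᵥ* J l R)) *ᵥ v = v + (a * form l R u v) • u := by
  rw [form, Matrix.toBilin'_apply', add_mulVec, one_mulVec, smul_mulVec, vecMulVec_mulVec,
    dotProduct_mulVec]
  ext; simp; ring

/-- The symplectic transvection `v ↦ v + a ω(u, v) u`. -/
def transvection (a : R) (u : l ⊕ l → R) : symplecticGroup l R :=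
  ⟨1 + a • vecMulVec u (u ᵥ* J l R), mem_iff_form.2 fun v w ↦ by
    simp only [transvection_mulVec, map_add, map_smul, LinearMap.add_apply, LinearMap.smul_apply,
      form_self, smul_eq_mul, form_swap v u]
    ring⟩

theorem transvection_smul (a : R) (u v : l ⊕ l → R) :
    transvection a u • v = v + (a * form l R u v) • u :=
  transvection_mulVec a u v

theorem transvection_smul_of_form_eq_zero (a : R) {u v : l ⊕ l → R} (h : form l R u v = 0) :
    transvection a u • v = v := by
  simp [transvection_smul, h]

theorem transvection_smul_right (a c : R) (u : l ⊕ l → R) :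
    transvection a (c • u) = transvection (a * c ^ 2) u :=
  ext_smul fun v ↦ by
    simp only [transvection_smul, map_smul, LinearMap.smul_apply, smul_smul, smul_eq_mul]
    congr 2; ring

theorem mul_transvection_mul_inv (g : symplecticGroup l R) (a : R) (u : l ⊕ l → R) :
    g * transvection a u * g⁻¹ = transvection a (g • u) :=
  ext_smul fun v ↦ by
    have h : form l R (g • u) v = form l R u (g⁻¹ • v) := by
      rw [← form_smul_smul g u, smul_inv_smul]
    rw [mul_smul, mul_smul, transvection_smul, transvection_smul, h, smul_add, smul_inv_smul,
      smul_comm]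

theorem transvection_sub_smul {a : R} {v w : l ⊕ l → R} (h : a * form l R w v = 1) :
    transvection a (w - v) • v = w := by
  simp [transvection_smul, form_self, h]

/-- For pairwise orthogonal vectors, an instance of the lantern relation. -/
theorem transvection_lantern (a : R) {x y z : l ⊕ l → R} (hxy : form l R x y = 0)
    (hyz : form l R y z = 0) (hxz : form l R x z = 0) :
    transvection a (x + y + z) * (transvection a x * transvection a y * transvection a z) =
      transvection a (x + y) * transvection a (y + z) * transvection a (x + z) :=
  ext_smul fun v ↦ by
    have hyx : form l R y x = 0 := by rw [form_swap, hxy, neg_zero]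
    have hzy : form l R z y = 0 := by rw [form_swap, hyz, neg_zero]
    have hzx : form l R z x = 0 := by rw [form_swap, hxz, neg_zero]
    simp only [mul_smul, transvection_smul, map_add, map_smul, LinearMap.add_apply,
      form_self, hxy, hyz, hxz, hyx, hzy, hzx, smul_zero, add_zero]
    ext p
    simp only [Pi.add_apply, Pi.smul_apply, smul_eq_mul]
    ring

theorem abelianization_of_transvection_smul (g : symplecticGroup l R) (a : R)
    (u : l ⊕ l → R) :
    Abelianization.of (transvection a (g • u)) = Abelianization.of (transvection a u) := by
  rw [← mul_transvection_mul_inv, map_mul, map_mul, map_inv, mul_inv_cancel_comm]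

theorem abelianization_of_transvection_eq (a : R) {v w : l ⊕ l → R}
    (h : IsUnit (form l R v w)) :
    Abelianization.of (transvection a v) = Abelianization.of (transvection a w) := by
  obtain ⟨b, hb⟩ := h.exists_right_inv
  rw [← transvection_sub_smul (a := b) (v := w) (w := v) (by rw [mul_comm, hb]),
    abelianization_of_transvection_smul]

theorem isUnit_form_single_inl_inr (i : l) :
    IsUnit (form l R (Pi.single (Sum.inl i) 1) (Pi.single (Sum.inr i) 1)) := by
  simp [form_single_inl]

theorem abelianization_of_transvection_single (hl : 2 < Fintype.card l) (a : R) (p : l ⊕ l) :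
    Abelianization.of (transvection a (Pi.single p 1 : l ⊕ l → R)) = 1 := by
  have inr_of_inl : ∀ i : l, Abelianization.of (transvection a (Pi.single (Sum.inl i) 1)) =
      Abelianization.of (transvection a (Pi.single (Sum.inr i) (1 : R) : l ⊕ l → R)) := fun i ↦
    abelianization_of_transvection_eq a (isUnit_form_single_inl_inr i)
  have main : ∀ i : l,
      Abelianization.of (transvection a (Pi.single (Sum.inl i) 1 : l ⊕ l → R)) = 1 := by
    intro i
    obtain ⟨j, hj⟩ := Finset.exists_mem_notMem_of_card_lt_card
      (s := {i}) (t := Finset.univ) (by simp; lia)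
    obtain ⟨k, hk⟩ := Finset.exists_mem_notMem_of_card_lt_card
      (s := {i, j}) (t := Finset.univ) (lt_of_le_of_lt Finset.card_le_two (by simpa using hl))
    simp only [Finset.mem_univ, Finset.mem_singleton, Finset.mem_insert, not_or, true_and]
      at hj hk
    have hij : i ≠ j := Ne.symm hj
    have hik : i ≠ k := Ne.symm hk.1
    have hjk : j ≠ k := Ne.symm hk.2
    set e : l → l ⊕ l → R := fun m ↦ Pi.single (Sum.inl m) 1 with he
    set f : l → l ⊕ l → R := fun m ↦ Pi.single (Sum.inr m) 1 with hf
    have toF : ∀ (m : l) (v : l ⊕ l → R), v (Sum.inl m) = 1 →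
        Abelianization.of (transvection a v) = Abelianization.of (transvection a (f m)) :=
      fun m v hv ↦ (abelianization_of_transvection_eq a (by simp [hf, form_single_inr, hv])).symm
    have eqz : ∀ m, m = i ∨ m = j ∨ m = k → Abelianization.of (transvection a (f m)) =
        Abelianization.of (transvection a (f i + f j + f k)) := by
      intro m hm
      rw [← inr_of_inl]
      refine abelianization_of_transvection_eq a ?_
      rcases hm with rfl | rfl | rfl <;> simp [form_single_inl, *]
    have h := congrArg Abelianization.of <| transvection_lantern a (x := e i) (y := e j)
      (z := e k) (by simp [he, form_single_inl]) (by simp [he, form_single_inl])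
      (by simp [he, form_single_inl])
    simp only [map_mul] at h
    rw [toF i (e i + e j + e k) (by simp [*]), toF i (e i) (by simp [he]),
      toF j (e j) (by simp [he]), toF k (e k) (by simp [he]), toF i (e i + e j) (by simp [*]),
      toF j (e j + e k) (by simp [*]), toF k (e i + e k) (by simp [*]),
      eqz i (by simp), eqz j (by simp), eqz k (by simp)] at h
    change Abelianization.of (transvection a (e i)) = 1
    rw [toF i (e i) (by simp [he]), eqz i (by simp)]
    simpa using h
  rcases p with i | i
  · exact main i
  · rw [← inr_of_inl, main]

theorem form_single_of_mem_supportedOff {S : Finset l} {v : l ⊕ l → R}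
    (hv : v ∈ supportedOff S) {p : l ⊕ l} (hp : Sum.elim id id p ∈ S) :
    form l R v (Pi.single p 1) = 0 := by
  rw [form_swap]
  rcases p with i | i
  · rw [form_single_inl, hv (Sum.inr i) hp]; simp
  · rw [form_single_inr, hv (Sum.inl i) hp]; simp

variable (R) in
/-- The subgroup generated by the transvections along vectors of `supportedOff S`. -/
def transvectionSubgroup (S : Finset l) : Subgroup (symplecticGroup l R) :=
  Subgroup.closure {g | ∃ a : R, ∃ u ∈ supportedOff S, g = transvection a u}

theorem transvection_mem_transvectionSubgroup {S : Finset l} (a : R) {u : l ⊕ l → R}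
    (hu : u ∈ supportedOff S) : transvection a u ∈ transvectionSubgroup R S :=
  Subgroup.subset_closure ⟨a, u, hu, rfl⟩

theorem smul_single_of_mem_transvectionSubgroup {S : Finset l} {g : symplecticGroup l R}
    (hg : g ∈ transvectionSubgroup R S) {p : l ⊕ l} (hp : Sum.elim id id p ∈ S) :
    g • (Pi.single p 1 : l ⊕ l → R) = Pi.single p 1 := by
  suffices transvectionSubgroup R S ≤
      MulAction.stabilizer (symplecticGroup l R) (Pi.single p 1 : l ⊕ l → R) from this hg
  refine (Subgroup.closure_le _).2 ?_
  rintro _ ⟨a, u, hu, rfl⟩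
  exact transvection_smul_of_form_eq_zero a (form_single_of_mem_supportedOff hu hp)

theorem exists_transvectionSubgroup_smul_eq {S : Finset l} {v w : l ⊕ l → R}
    (hv : v ∈ supportedOff S) (hw : w ∈ supportedOff S) (h : IsUnit (form l R w v)) :
    ∃ g ∈ transvectionSubgroup R S, g • v = w := by
  obtain ⟨b, hb⟩ := h.exists_left_inv
  exact ⟨_, transvection_mem_transvectionSubgroup b (sub_mem hw hv), transvection_sub_smul hb⟩

/-- An element fixing the basis vectors with index in `S` preserves `supportedOff S`. -/
theorem smul_mem_supportedOff {S : Finset l} {g : symplecticGroup l R}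
    (hg : ∀ p, Sum.elim id id p ∈ S → g • (Pi.single p 1 : l ⊕ l → R) = Pi.single p 1)
    {v : l ⊕ l → R} (hv : v ∈ supportedOff S) : g • v ∈ supportedOff S := by
  have key : ∀ p, Sum.elim id id p ∈ S → form l R (Pi.single p 1) (g • v) = 0 := by
    intro p hp
    rw [← hg p hp, form_smul_smul, form_swap, form_single_of_mem_supportedOff hv hp, neg_zero]
  rintro (i | i) hp
  · simpa [form_single_inr] using key (Sum.inr i) hp
  · simpa [form_single_inl] using key (Sum.inl i) hp

/-- The Eichler transformations attached to orthogonal vectors are products of transvections. -/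
theorem exists_transvectionSubgroup_eichler {S : Finset l} (a : R) {x y : l ⊕ l → R}
    (hx : x ∈ supportedOff S) (hy : y ∈ supportedOff S) (hxy : form l R x y = 0) :
    ∃ g ∈ transvectionSubgroup R S, ∀ v : l ⊕ l → R,
      g • v = v + (a * form l R x v) • y + (a * form l R y v) • x := by
  refine ⟨transvection a (x + y) * (transvection (-a) x * transvection (-a) y),
    mul_mem (transvection_mem_transvectionSubgroup _ (add_mem hx hy))
      (mul_mem (transvection_mem_transvectionSubgroup _ hx)
        (transvection_mem_transvectionSubgroup _ hy)), fun v ↦ ?_⟩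
  have hyx : form l R y x = 0 := by rw [form_swap, hxy, neg_zero]
  simp only [mul_smul, transvection_smul, map_add, map_smul, LinearMap.add_apply,
    form_self, hxy, hyx, smul_zero, add_zero]
  ext p
  simp only [Pi.add_apply, Pi.smul_apply, smul_eq_mul]
  ring

end CommRing

section Int

variable {l : Type*} [DecidableEq l] [Fintype l]

theorem exists_natAbs_add_mul_lt {x y : ℤ} (hy : y ≠ 0) (h : y.natAbs ≤ x.natAbs) :
    ∃ a : ℤ, (x + a * y).natAbs < x.natAbs := by
  rcases le_total 0 x with hx | hx <;> rcases le_total 0 y with hy' | hy'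
  · exact ⟨-1, by lia⟩
  · exact ⟨1, by lia⟩
  · exact ⟨1, by lia⟩
  · exact ⟨-1, by lia⟩

theorem sum_natAbs_add_single_lt {ι : Type*} [Fintype ι] [DecidableEq ι] {v : ι → ℤ} {p : ι}
    {c : ℤ} (h : (v p + c).natAbs < (v p).natAbs) :
    ∑ q, ((v + c • Pi.single p 1 : ι → ℤ) q).natAbs < ∑ q, (v q).natAbs := by
  refine Finset.sum_lt_sum (fun q _ ↦ ?_) ⟨p, Finset.mem_univ p, by simpa using h⟩
  rcases eq_or_ne q p with rfl | hq
  · simpa using h.le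
  · simp [hq]

theorem natAbs_form_single (p : l ⊕ l) (v : l ⊕ l → ℤ) :
    (form l ℤ (Pi.single p 1) v).natAbs = (v p.swap).natAbs := by
  rcases p with i | i <;> simp [form_single_inl, form_single_inr]

theorem exists_reduction_of_dual {S : Finset l} {v : l ⊕ l → ℤ} (hv : v ∈ supportedOff S)
    {p : l ⊕ l} (hp : v p ≠ 0) (hp' : v p.swap ≠ 0) :
    ∃ g ∈ transvectionSubgroup ℤ S, g • v ∈ supportedOff S ∧
      ∑ q, ((g • v) q).natAbs < ∑ q, (v q).natAbs := by
  wlog hle : (v p.swap).natAbs ≤ (v p).natAbs generalizing p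
  · exact this (p := p.swap) hp' (by simpa using hp) (by simpa using (not_le.1 hle).le)
  have hs : (Pi.single p 1 : l ⊕ l → ℤ) ∈ supportedOff S :=
    single_mem_supportedOff fun h ↦ hp (hv p h)
  obtain ⟨a, ha⟩ := exists_natAbs_add_mul_lt (x := v p) (y := form l ℤ (Pi.single p 1) v)
    (by rwa [← Int.natAbs_ne_zero, natAbs_form_single, Int.natAbs_ne_zero])
    (by rwa [natAbs_form_single])
  refine ⟨_, transvection_mem_transvectionSubgroup a hs, ?_⟩
  rw [transvection_smul]
  exact ⟨add_mem hv (Submodule.smul_mem _ _ hs), sum_natAbs_add_single_lt ha⟩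

theorem exists_reduction_of_orthogonal {S : Finset l} {v : l ⊕ l → ℤ} (hv : v ∈ supportedOff S)
    {p q : l ⊕ l} (hpq : p ≠ q) (hp : v p ≠ 0) (hq : v q ≠ 0) (hp' : v p.swap = 0)
    (hq' : v q.swap = 0) :
    ∃ g ∈ transvectionSubgroup ℤ S, g • v ∈ supportedOff S ∧
      ∑ q, ((g • v) q).natAbs < ∑ q, (v q).natAbs := by
  wlog hle : (v q).natAbs ≤ (v p).natAbs generalizing p q
  · exact this hpq.symm hq hp hq' hp' (not_le.1 hle).le
  have hs : (Pi.single p 1 : l ⊕ l → ℤ) ∈ supportedOff S :=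
    single_mem_supportedOff fun h ↦ hp (hv p h)
  have hs' : (Pi.single q.swap 1 : l ⊕ l → ℤ) ∈ supportedOff S :=
    single_mem_supportedOff fun h ↦ hq (hv q (by rcases q with i | i <;> exact h))
  obtain ⟨a, ha⟩ := exists_natAbs_add_mul_lt (x := v p) (y := form l ℤ (Pi.single q.swap 1) v)
    (by rwa [← Int.natAbs_ne_zero, natAbs_form_single, Int.natAbs_ne_zero, Sum.swap_swap])
    (by rwa [natAbs_form_single, Sum.swap_swap])
  have h0 : form l ℤ (Pi.single p 1) v = 0 := by
    rw [← Int.natAbs_eq_zero, natAbs_form_single, hp', Int.natAbs_zero]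
  have hxy : form l ℤ (Pi.single p 1) (Pi.single q.swap 1) = 0 := by
    rw [← Int.natAbs_eq_zero, natAbs_form_single, Int.natAbs_eq_zero]
    exact Pi.single_eq_of_ne (fun h ↦ hpq (Sum.swap_leftInverse.injective h)) 1
  obtain ⟨g, hg, hgv⟩ := exists_transvectionSubgroup_eichler a hs hs' hxy
  refine ⟨g, hg, ?_⟩
  rw [hgv, h0, mul_zero, zero_smul, add_zero]
  exact ⟨add_mem hv (Submodule.smul_mem _ _ hs), sum_natAbs_add_single_lt ha⟩

/-- Euclid's algorithm by transvections: a vector can be moved to a multiple of a basis vector. -/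
theorem exists_smul_eq_smul_single [Nonempty l] {S : Finset l} (v : l ⊕ l → ℤ)
    (hv : v ∈ supportedOff S) :
    ∃ g ∈ transvectionSubgroup ℤ S, ∃ (c : ℤ) (p : l ⊕ l), g • v = c • Pi.single p 1 := by
  induction hN : ∑ q, (v q).natAbs using Nat.strong_induction_on generalizing v with
  | _ N ih =>
    subst hN
    by_cases hred : ∃ g ∈ transvectionSubgroup ℤ S, g • v ∈ supportedOff S ∧
        ∑ q, ((g • v) q).natAbs < ∑ q, (v q).natAbs
    · obtain ⟨g, hg, hgv, hlt⟩ := hred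
      obtain ⟨h, hh, c, p, hcp⟩ := ih _ hlt (g • v) hgv rfl
      exact ⟨h * g, mul_mem hh hg, c, p, by rw [mul_smul, hcp]⟩
    · have hdual : ∀ p, v p ≠ 0 → v p.swap = 0 := fun p hp ↦ by
        by_contra hp'
        exact hred (exists_reduction_of_dual hv hp hp')
      obtain ⟨p, hp⟩ : ∃ p, ∀ q ≠ p, v q = 0 := by
        by_cases h0 : ∃ p, v p ≠ 0
        · obtain ⟨p, hp⟩ := h0
          refine ⟨p, fun q hqp ↦ ?_⟩
          by_contra hq
          exact hred (exists_reduction_of_orthogonal hv hqp hq hp (hdual q hq) (hdual p hp))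
        · push Not at h0
          exact ⟨Sum.inl (Classical.arbitrary l), fun q _ ↦ h0 q⟩
      refine ⟨1, one_mem _, v p, p, ?_⟩
      ext q
      rcases eq_or_ne q p with rfl | hq
      · simp
      · simp [hq, hp q hq]

theorem transvection_mem_commutator (hl : 2 < Fintype.card l) (a : ℤ) (u : l ⊕ l → ℤ) :
    transvection a u ∈ commutator (symplecticGroup l ℤ) := by
  have : Nonempty l := Fintype.card_pos_iff.1 (by lia)
  obtain ⟨g, -, c, p, hg⟩ := exists_smul_eq_smul_single (S := ∅) u (fun _ h ↦ by simp at h)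
  rw [← Abelianization.ker_of, MonoidHom.mem_ker, ← abelianization_of_transvection_smul g, hg,
    transvection_smul_right, abelianization_of_transvection_single hl]

theorem transvectionSubgroup_le_commutator (hl : 2 < Fintype.card l) (S : Finset l) :
    transvectionSubgroup ℤ S ≤ commutator (symplecticGroup l ℤ) := by
  refine (Subgroup.closure_le _).2 ?_
  rintro _ ⟨a, u, -, rfl⟩
  exact transvection_mem_commutator hl a u

/-- A vector completing to a hyperbolic pair can be moved to any given basis vector. -/
theorem exists_smul_eq_single_inl {S : Finset l} {j : l} (hj : j ∉ S) {v w : l ⊕ l → ℤ}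
    (hv : v ∈ supportedOff S) (hvw : IsUnit (form l ℤ v w)) :
    ∃ g ∈ transvectionSubgroup ℤ S, g • v = Pi.single (Sum.inl j) 1 := by
  have : Nonempty l := ⟨j⟩
  obtain ⟨g, hg, c, p, hgv⟩ := exists_smul_eq_smul_single v hv
  have hc : IsUnit c := by
    rw [← form_smul_smul g, hgv, LinearMap.map_smul, LinearMap.smul_apply, smul_eq_mul] at hvw
    exact isUnit_of_mul_isUnit_left hvw
  have hgS : g • v ∈ supportedOff S :=
    smul_mem_supportedOff (fun p hp ↦ smul_single_of_mem_transvectionSubgroup hg hp) hv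
  have hp : Sum.elim id id p ∉ S := fun h ↦ hc.ne_zero (by simpa [hgv] using hgS p h)
  obtain ⟨z, hz, hzv, hzj⟩ : ∃ z ∈ supportedOff S, IsUnit (form l ℤ z (g • v)) ∧
      IsUnit (form l ℤ (Pi.single (Sum.inl j) 1) z) := by
    have hjS : (Pi.single (Sum.inr j) 1 : l ⊕ l → ℤ) ∈ supportedOff S :=
      single_mem_supportedOff hj
    by_cases hpj : p = Sum.inl j
    · exact ⟨Pi.single (Sum.inr j) 1, hjS, by simpa [hgv, form_single_inr, hpj] using hc,
        isUnit_form_single_inl_inr j⟩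
    · have hpS : (Pi.single p.swap 1 : l ⊕ l → ℤ) ∈ supportedOff S :=
        single_mem_supportedOff (by rcases p with i | i <;> exact hp)
      refine ⟨Pi.single p.swap 1 + Pi.single (Sum.inr j) 1, add_mem hpS hjS, ?_, ?_⟩
      · rcases p with i | i <;>
          simp_all [form_single_inl, form_single_inr, eq_comm]
      · rcases p with i | i <;> simp_all [form_single_inl, eq_comm]
  obtain ⟨g₁, hg₁, h₁⟩ := exists_transvectionSubgroup_smul_eq hgS hz hzv
  obtain ⟨g₂, hg₂, h₂⟩ := exists_transvectionSubgroup_smul_eq hz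
    (single_mem_supportedOff (p := Sum.inl j) hj) hzj
  exact ⟨g₂ * (g₁ * g), mul_mem hg₂ (mul_mem hg₁ hg), by rw [mul_smul, mul_smul, h₁, h₂]⟩

/-- Two vectors pairing to the same unit with `e` are related by transvections fixing `e`. -/
theorem exists_smul_eq_and_smul_eq {S : Finset l} {e v w : l ⊕ l → ℤ} (he : e ∈ supportedOff S)
    (hv : v ∈ supportedOff S) (hw : w ∈ supportedOff S) (hew : IsUnit (form l ℤ e w))
    (h : form l ℤ e v = form l ℤ e w) :
    ∃ g ∈ transvectionSubgroup ℤ S, g • e = e ∧ g • v = w := by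
  obtain ⟨b, hb⟩ := hew.exists_left_inv
  set c := b * (1 - form l ℤ w v) with hc
  have h₁ : form l ℤ (w + c • e) v = 1 := by
    rw [map_add, map_smul, LinearMap.add_apply, LinearMap.smul_apply, h, smul_eq_mul, hc]
    linear_combination (1 - form l ℤ w v) * hb
  refine ⟨transvection (-c * b) e * transvection 1 (w + c • e - v),
    mul_mem (transvection_mem_transvectionSubgroup _ he) (transvection_mem_transvectionSubgroup _
      (sub_mem (add_mem hw (Submodule.smul_mem _ _ he)) hv)), ?_, ?_⟩
  · rw [mul_smul, transvection_smul_of_form_eq_zero 1,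
      transvection_smul_of_form_eq_zero _ (form_self e)]
    rw [form_swap, map_sub, map_add, map_smul, form_self, h]
    simp
  · rw [mul_smul, transvection_sub_smul (by rw [h₁, one_mul]), transvection_smul, map_add,
      map_smul, form_self, smul_zero, add_zero, mul_assoc, hb, mul_one]
    simp

theorem mem_commutator_of_smul_single_eq (hl : 2 < Fintype.card l) (S : Finset l)
    (A : symplecticGroup l ℤ)
    (hA : ∀ p, Sum.elim id id p ∈ S → A • (Pi.single p 1 : l ⊕ l → ℤ) = Pi.single p 1) :
    A ∈ commutator (symplecticGroup l ℤ) := by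
  induction hN : Sᶜ.card generalizing S A with
  | zero =>
    rw [Finset.card_eq_zero, Finset.compl_eq_empty_iff] at hN
    have : A = 1 := ext_smul_single fun p ↦ by rw [hA p (by simp [hN]), one_smul]
    exact this ▸ one_mem _
  | succ N ih =>
    obtain ⟨j, hj⟩ : Sᶜ.Nonempty := Finset.card_pos.1 (by lia)
    have hjS : j ∉ S := Finset.mem_compl.1 hj
    set e : l ⊕ l → ℤ := Pi.single (Sum.inl j) 1 with he
    set f : l ⊕ l → ℤ := Pi.single (Sum.inr j) 1 with hf
    have heS : e ∈ supportedOff S := single_mem_supportedOff hjS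
    have hfS : f ∈ supportedOff S := single_mem_supportedOff hjS
    have hef : IsUnit (form l ℤ e f) := isUnit_form_single_inl_inr j
    obtain ⟨g, hg, hge⟩ := exists_smul_eq_single_inl hjS (smul_mem_supportedOff hA heS)
      (w := A • f) (by rwa [form_smul_smul])
    have hgA : ∀ p, Sum.elim id id p ∈ S →
        (g * A) • (Pi.single p 1 : l ⊕ l → ℤ) = Pi.single p 1 := fun p hp ↦ by
      rw [mul_smul, hA p hp, smul_single_of_mem_transvectionSubgroup hg hp]
    have hgAe : (g * A) • e = e := by rw [mul_smul, hge]
    obtain ⟨h, hh, hhe, hhf⟩ := exists_smul_eq_and_smul_eq heS (smul_mem_supportedOff hgA hfS)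
      hfS hef (by rw [← form_smul_smul (g * A) e f, hgAe])
    have hmem := ih (insert j S) (h * (g * A)) (fun p hp ↦ ?_)
      (by rw [Finset.compl_insert, Finset.card_erase_of_mem hj, hN, Nat.add_sub_cancel])
    · have hle := transvectionSubgroup_le_commutator hl S
      rwa [Subgroup.mul_mem_cancel_left _ (hle hh), Subgroup.mul_mem_cancel_left _ (hle hg)]
        at hmem
    · rcases Finset.mem_insert.1 hp with hpj | hpS
      · rcases p with i | i
        · obtain rfl : i = j := hpj
          rw [mul_smul, hgAe, hhe]
        · obtain rfl : i = j := hpj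
          rw [mul_smul, hhf]
      · rw [mul_smul, hgA p hpS, smul_single_of_mem_transvectionSubgroup hh hpS]

end Int

end SymplecticGroup

/-- For `n ≥ 3`, the group `Sp(2n,ℤ)` is perfect: it equals its own commutator
subgroup. -/
theorem symplecticGroup_int_perfect (n : ℕ) (hn : 3 ≤ n) :
    commutator (Matrix.symplecticGroup (Fin n) ℤ) = ⊤ := by
  refine (Subgroup.eq_top_iff' _).2 fun A ↦
    SymplecticGroup.mem_commutator_of_smul_single_eq
      (by rwa [Fintype.card_fin]) ∅ A (by simp)
end

section
/- The abelianization of Sp(4,ℤ) is isomorphic to ℤ/2ℤ; that is, the quotient of Sp(4,ℤ) by its commutator subgroup is a group of order 2. -/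
namespace Sp4

open Matrix MatrixGroups

lemma zero_fin_two : (0 : Matrix (Fin 2) (Fin 2) ℤ) = !![0, 0; 0, 0] :=
  eta_fin_two 0

/-- `SL(2)` acting on the first hyperbolic plane. -/
def plane₁ : SL(2, ℤ) →* symplecticGroup (Fin 2) ℤ where
  toFun g := ⟨fromBlocks !![g 0 0, 0; 0, 1] !![g 0 1, 0; 0, 0] !![g 1 0, 0; 0, 0]
    !![g 1 1, 0; 0, 1], by
    have h := g.det_coe
    rw [det_fin_two] at h
    rw [SymplecticGroup.fromBlocks_mem_iff]
    refine ⟨?_, ?_, ?_⟩ <;> ext i j <;> fin_cases i <;> fin_cases j <;>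
      simp [Matrix.mul_apply, Fin.sum_univ_two] <;> first | ring1 | linear_combination h⟩
  map_one' := by
    apply Subtype.ext
    simp [← one_fin_two, ← zero_fin_two]
  map_mul' g h := by
    apply Subtype.ext
    simp only [Submonoid.coe_mul, fromBlocks_multiply]
    simp [Matrix.mul_apply]

/-- `SL(2)` acting on the second hyperbolic plane. -/
def plane₂ : SL(2, ℤ) →* symplecticGroup (Fin 2) ℤ where
  toFun g := ⟨fromBlocks !![1, 0; 0, g 0 0] !![0, 0; 0, g 0 1] !![0, 0; 0, g 1 0]
    !![1, 0; 0, g 1 1], by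
    have h := g.det_coe
    rw [det_fin_two] at h
    rw [SymplecticGroup.fromBlocks_mem_iff]
    refine ⟨?_, ?_, ?_⟩ <;> ext i j <;> fin_cases i <;> fin_cases j <;>
      simp [Matrix.mul_apply, Fin.sum_univ_two] <;> first | ring1 | linear_combination h⟩
  map_one' := by
    apply Subtype.ext
    simp [← one_fin_two, ← zero_fin_two]
  map_mul' g h := by
    apply Subtype.ext
    simp only [Submonoid.coe_mul, fromBlocks_multiply]
    simp [Matrix.mul_apply]

/-- The Levi embedding `g ↦ diag(g, g⁻ᵀ)` of `SL(2)`. -/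
def levi : SL(2, ℤ) →* symplecticGroup (Fin 2) ℤ where
  toFun g := ⟨fromBlocks !![g 0 0, g 0 1; g 1 0, g 1 1] 0 0 !![g 1 1, -g 1 0; -g 0 1, g 0 0], by
    have h := g.det_coe
    rw [det_fin_two] at h
    rw [SymplecticGroup.fromBlocks_mem_iff]
    refine ⟨?_, ?_, ?_⟩ <;> ext i j <;> fin_cases i <;> fin_cases j <;>
      simp [Matrix.mul_apply, Fin.sum_univ_two] <;> first | ring1 | linear_combination h⟩
  map_one' := by
    apply Subtype.ext
    simp [← one_fin_two]
  map_mul' g h := by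
    apply Subtype.ext
    simp only [Submonoid.coe_mul, fromBlocks_multiply]
    simp [Matrix.mul_apply, add_comm]

/-- The upper unipotent matrix with off-diagonal symmetric block `[0, b; b, 0]`. -/
def mixed (b : ℤ) : symplecticGroup (Fin 2) ℤ :=
  ⟨fromBlocks 1 !![0, b; b, 0] 0 1, by
    rw [SymplecticGroup.fromBlocks_mem_iff]
    refine ⟨?_, ?_, ?_⟩ <;> ext i j <;> fin_cases i <;> fin_cases j <;> simp⟩

open ModularGroup

lemma levi_mul_plane₂ : levi T * plane₂ T = plane₁ T * plane₂ T * mixed 1 * levi T := by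
  apply Subtype.ext
  simp [levi, plane₁, plane₂, mixed, T, fromBlocks_multiply, one_fin_two, zero_fin_two]

lemma levi_mul_mixed : levi T * mixed 1 = plane₁ T * plane₁ T * mixed 1 * levi T := by
  apply Subtype.ext
  simp [levi, plane₁, mixed, T, fromBlocks_multiply, one_fin_two, zero_fin_two]

lemma levi_mul_plane₁ : levi S * plane₁ T = plane₂ T * levi S := by
  apply Subtype.ext
  simp [levi, plane₁, plane₂, T, S, fromBlocks_multiply, zero_fin_two]

lemma mixed_mul_plane₂ (b : ℤ) : mixed b * plane₂ S = plane₂ S * levi (T ^ b) := by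
  apply Subtype.ext
  simp [levi, plane₂, mixed, coe_T_zpow, S, fromBlocks_multiply, one_fin_two, zero_fin_two]

lemma S_eq : S = T⁻¹ * (S * T⁻¹ * S⁻¹) * T⁻¹ := by
  decide

lemma map_S {A : Type*} [CommGroup A] (φ : SL(2, ℤ) →* A) : φ S = φ T ^ (-3 : ℤ) := by
  have h := congrArg φ S_eq
  simp only [map_mul, map_inv, mul_inv_cancel_comm] at h
  rw [h]
  group

lemma map_mem_zpowers {A : Type*} [CommGroup A] (φ : SL(2, ℤ) →* A) (g : SL(2, ℤ)) :
    φ g ∈ Subgroup.zpowers (φ T) := by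
  have h : (⊤ : Subgroup SL(2, ℤ)) ≤ (Subgroup.zpowers (φ T)).comap φ := by
    rw [← SpecialLinearGroup.SL2Z_generators, Subgroup.closure_le]
    rintro x (rfl | rfl)
    · exact ⟨-3, (map_S φ).symm⟩
    · exact Subgroup.mem_zpowers _
  exact h (Subgroup.mem_top g)

lemma exists_SL2_col_reduction (a c : ℤ) :
    ∃ (g : SL(2, ℤ)) (k : ℤ), 0 ≤ k ∧ g 0 0 * a + g 0 1 * c = k ∧ g 1 0 * a + g 1 1 * c = 0 := by
  rcases eq_or_ne (Int.gcd a c) 0 with h | h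
  · obtain ⟨rfl, rfl⟩ := Int.gcd_eq_zero_iff.1 h
    exact ⟨1, 0, by simp⟩
  · have h0 : (Int.gcd a c : ℤ) ≠ 0 := by exact_mod_cast h
    obtain ⟨a', ha⟩ := Int.gcd_dvd_left a c
    obtain ⟨c', hc⟩ := Int.gcd_dvd_right a c
    have hb := Int.gcd_eq_gcd_ab a c
    refine ⟨⟨!![a.gcdA c, a.gcdB c; -c', a'], ?_⟩, Int.gcd a c, by positivity, ?_, ?_⟩
    · rw [det_fin_two_of]
      apply mul_left_cancel₀ h0
      linear_combination - hb - a.gcdA c * ha - a.gcdB c * hc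
    · simp
      linear_combination -hb
    · simp
      linear_combination -c' * ha + a' * hc

lemma levi_plane_relations {A : Type*} [CommGroup A] (f : symplecticGroup (Fin 2) ℤ →* A) :
    f (plane₂ T) = f (plane₁ T) ∧ f (levi T) = f (plane₁ T) ∧ f (plane₁ T) ^ 2 = 1 := by
  have h₁ := congrArg f levi_mul_plane₁
  have h₂ := congrArg f levi_mul_plane₂
  have h₃ := congrArg f levi_mul_mixed
  have h₄ := congrArg f (mixed_mul_plane₂ 1)
  simp only [map_mul, zpow_one] at h₁ h₂ h₃ h₄
  rw [mul_comm, mul_right_cancel_iff] at h₁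
  rw [mul_comm, mul_right_cancel_iff] at h₃
  rw [mul_comm, mul_left_cancel_iff] at h₄
  rw [mul_comm, mul_right_cancel_iff] at h₂
  have hsq : f (plane₁ T) ^ 2 = 1 := by simpa [sq] using h₃
  refine ⟨h₁.symm, ?_, hsq⟩
  rw [mul_right_comm, eq_comm, mul_eq_right, h₄] at h₂
  rw [← mul_right_cancel_iff (a := f (plane₁ T)), ← sq, hsq, mul_comm, h₂]

open Sum in
lemma form_apply (M : symplecticGroup (Fin 2) ℤ) (i j : Fin 2 ⊕ Fin 2) :
    M.1 (inl 0) i * M.1 (inr 0) j + M.1 (inl 1) i * M.1 (inr 1) j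
      - M.1 (inr 0) i * M.1 (inl 0) j - M.1 (inr 1) i * M.1 (inl 1) j = - J (Fin 2) ℤ i j := by
  have h := congrFun₂ (SymplecticGroup.mem_iff'.1 M.2) i j
  simp [J, Matrix.mul_apply, Fintype.sum_sum_type, Fin.sum_univ_two, one_apply] at h ⊢
  rw [← h]
  ring

section Generation

variable {H : Subgroup (symplecticGroup (Fin 2) ℤ)} (h₁ : ∀ g, plane₁ g ∈ H)
  (h₂ : ∀ g, plane₂ g ∈ H) (h₃ : ∀ g, levi g ∈ H)

include h₁ h₂ h₃

open Sum

lemma mem_of_unipotent (M : symplecticGroup (Fin 2) ℤ)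
    (h00 : M.1 (inl 0) (inl 0) = 1) (h10 : M.1 (inl 1) (inl 0) = 0)
    (h20 : M.1 (inr 0) (inl 0) = 0) (h30 : M.1 (inr 1) (inl 0) = 0)
    (h11 : M.1 (inl 1) (inl 1) = 1) (h13 : M.1 (inl 1) (inr 1) = 0)
    (h31 : M.1 (inr 1) (inl 1) = 0) (h33 : M.1 (inr 1) (inr 1) = 1) : M ∈ H := by
  have hm (b : ℤ) : mixed b ∈ H :=
    (H.mul_mem_cancel_right (h₂ S)).1 (mixed_mul_plane₂ b ▸ H.mul_mem (h₂ S) (h₃ _))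
  have e01 := form_apply M (inl 0) (inl 1)
  have e02 := form_apply M (inl 0) (inr 0)
  have e03 := form_apply M (inl 0) (inr 1)
  have e12 := form_apply M (inl 1) (inr 0)
  have e23 := form_apply M (inr 0) (inr 1)
  simp [J, h00, h10, h20, h30, h11, h13, h31, h33] at e01 e02 e03 e12 e23
  simp [e01, e02, e03] at e12 e23
  suffices h : M = levi (T ^ M.1 (inl 0) (inl 1)) *
      plane₁ (T ^ (M.1 (inl 0) (inr 0) - M.1 (inl 0) (inl 1) * M.1 (inl 1) (inr 0))) *
      mixed (M.1 (inl 1) (inr 0)) by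
    rw [h]
    exact H.mul_mem (H.mul_mem (h₃ _) (h₁ _)) (hm _)
  apply Subtype.ext
  rw [← fromBlocks_toBlocks M.1]
  simp [levi, plane₁, mixed, coe_T_zpow, fromBlocks_multiply, one_fin_two]
  refine ⟨?_, ?_, ?_, ?_⟩ <;> ext i j <;> fin_cases i <;> fin_cases j <;>
    simp [toBlocks₁₁, toBlocks₁₂, toBlocks₂₁, toBlocks₂₂, *] <;>
    first | linear_combination e12 | linear_combination -e23

lemma mem_of_fixed_vector (M : symplecticGroup (Fin 2) ℤ)
    (h00 : M.1 (inl 0) (inl 0) = 1) (h10 : M.1 (inl 1) (inl 0) = 0)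
    (h20 : M.1 (inr 0) (inl 0) = 0) (h30 : M.1 (inr 1) (inl 0) = 0) : M ∈ H := by
  have e01 := form_apply M (inl 0) (inl 1)
  have e03 := form_apply M (inl 0) (inr 1)
  have e13 := form_apply M (inl 1) (inr 1)
  simp [J, h00, h10, h20, h30] at e01 e03 e13
  simp [e01, e03] at e13
  let g : SL(2, ℤ) := ⟨!![M.1 (inr 1) (inr 1), -M.1 (inl 1) (inr 1);
    -M.1 (inr 1) (inl 1), M.1 (inl 1) (inl 1)], by rw [det_fin_two_of]; linear_combination e13⟩
  rw [← H.mul_mem_cancel_left (h₂ g)]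
  apply mem_of_unipotent h₁ h₂ h₃ <;>
    simp [plane₂, g, Matrix.mul_apply, Fintype.sum_sum_type, h00, h10, h20, h30] <;>
    first | ring1 | linear_combination e13

/-- The three copies of `SL(2, ℤ)` generate `Sp(4, ℤ)`. -/
lemma mem_of_forall_mem (M : symplecticGroup (Fin 2) ℤ) : M ∈ H := by
  obtain ⟨g₁, k₁, -, hk₁, hz₁⟩ :=
    exists_SL2_col_reduction (M.1 (inl 0) (inl 0)) (M.1 (inr 0) (inl 0))
  obtain ⟨g₂, k₂, -, hk₂, hz₂⟩ :=
    exists_SL2_col_reduction (M.1 (inl 1) (inl 0)) (M.1 (inr 1) (inl 0))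
  obtain ⟨g₃, k, hk, hk₃, hz₃⟩ := exists_SL2_col_reduction k₁ k₂
  rw [← H.mul_mem_cancel_left (h₁ g₁), ← H.mul_mem_cancel_left (h₂ g₂),
    ← H.mul_mem_cancel_left (h₃ g₃)]
  set N := levi g₃ * (plane₂ g₂ * (plane₁ g₁ * M)) with hN
  have h00 : N.1 (inl 0) (inl 0) = k := by
    simp [hN, levi, plane₁, plane₂, Matrix.mul_apply, Fintype.sum_sum_type, hk₁, hk₂, hk₃]
  have h10 : N.1 (inl 1) (inl 0) = 0 := by
    simp [hN, levi, plane₁, plane₂, Matrix.mul_apply, Fintype.sum_sum_type, hk₁, hk₂, hz₃]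
  have h20 : N.1 (inr 0) (inl 0) = 0 := by
    simp [hN, levi, plane₁, plane₂, Matrix.mul_apply, Fintype.sum_sum_type, hz₁, hz₂]
  have h30 : N.1 (inr 1) (inl 0) = 0 := by
    simp [hN, levi, plane₁, plane₂, Matrix.mul_apply, Fintype.sum_sum_type, hz₁, hz₂]
  have e := form_apply N (inl 0) (inr 0)
  simp [J, h00, h10, h20, h30] at e
  exact mem_of_fixed_vector h₁ h₂ h₃ N (h00.trans (Int.eq_one_of_mul_eq_one_right hk e)) h10 h20 h30

end Generation
section QuadraticForms

open Sum

/-- The quadratic form on `(ℤ/2)⁴` refining the symplectic form, with value `c i` at the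
basis vector `i`. -/
def quad (c v : Fin 2 ⊕ Fin 2 → ZMod 2) : ZMod 2 :=
  v (inl 0) * v (inr 0) + v (inl 1) * v (inr 1) + c ⬝ᵥ v

/-- Reduction modulo two. -/
def red : symplecticGroup (Fin 2) ℤ →* Matrix (Fin 2 ⊕ Fin 2) (Fin 2 ⊕ Fin 2) (ZMod 2) :=
  (Int.castRingHom (ZMod 2)).mapMatrix.toMonoidHom.comp (Submonoid.subtype _)

lemma red_form_apply (M : symplecticGroup (Fin 2) ℤ) (i j : Fin 2 ⊕ Fin 2) :
    red M (inl 0) i * red M (inr 0) j + red M (inl 1) i * red M (inr 1) j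
      + red M (inr 0) i * red M (inl 0) j + red M (inr 1) i * red M (inl 1) j =
      (J (Fin 2) ℤ i j : ZMod 2) := by
  have h := congrArg (Int.cast : ℤ → ZMod 2) (form_apply M i j)
  push_cast at h
  simp only [CharTwo.neg_eq, CharTwo.sub_eq_add] at h
  exact h

/-- The parameter of the pull-back of `quad c` along `M`. -/
def pull (M : symplecticGroup (Fin 2) ℤ) (c : Fin 2 ⊕ Fin 2 → ZMod 2) : Fin 2 ⊕ Fin 2 → ZMod 2 :=
  fun i ↦ quad c ((red M).col i)

lemma quad_pull (M : symplecticGroup (Fin 2) ℤ) (c v : Fin 2 ⊕ Fin 2 → ZMod 2) :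
    quad (pull M c) v = quad c (red M *ᵥ v) := by
  have hv (x : ZMod 2) : x * x = x := by revert x; decide
  have e01 := red_form_apply M (inl 0) (inl 1)
  have e02 := red_form_apply M (inl 0) (inr 0)
  have e03 := red_form_apply M (inl 0) (inr 1)
  have e12 := red_form_apply M (inl 1) (inr 0)
  have e13 := red_form_apply M (inl 1) (inr 1)
  have e23 := red_form_apply M (inr 0) (inr 1)
  simp [J] at e01 e02 e03 e12 e13 e23
  simp only [quad, pull, dotProduct, mulVec, Fintype.sum_sum_type, Fin.sum_univ_two, col_apply]
  generalize red M = m at *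
  linear_combination
    -(v (inl 0) * v (inl 1)) * e01 - (v (inl 0) * v (inr 0)) * e02 - (v (inl 0) * v (inr 1)) * e03
    - (v (inl 1) * v (inr 0)) * e12 - (v (inl 1) * v (inr 1)) * e13 - (v (inr 0) * v (inr 1)) * e23
    - (m (inl 0) (inl 0) * m (inr 0) (inl 0) + m (inl 1) (inl 0) * m (inr 1) (inl 0))
      * hv (v (inl 0))
    - (m (inl 0) (inl 1) * m (inr 0) (inl 1) + m (inl 1) (inl 1) * m (inr 1) (inl 1))
      * hv (v (inl 1))
    - (m (inl 0) (inr 0) * m (inr 0) (inr 0) + m (inl 1) (inr 0) * m (inr 1) (inr 0))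
      * hv (v (inr 0))
    - (m (inl 0) (inr 1) * m (inr 0) (inr 1) + m (inl 1) (inr 1) * m (inr 1) (inr 1))
      * hv (v (inr 1))

lemma pull_one (c : Fin 2 ⊕ Fin 2 → ZMod 2) : pull 1 c = c := by
  ext i
  rcases i with i | i <;> fin_cases i <;> simp [pull, quad, one_apply, dotProduct]

lemma pull_mul (M N : symplecticGroup (Fin 2) ℤ) (c : Fin 2 ⊕ Fin 2 → ZMod 2) :
    pull (M * N) c = pull N (pull M c) := by
  ext i
  rw [pull, pull, quad_pull, map_mul]
  rfl

lemma red_mulVec_inv (M : symplecticGroup (Fin 2) ℤ) (v : Fin 2 ⊕ Fin 2 → ZMod 2) :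
    red M *ᵥ red M⁻¹ *ᵥ v = v := by
  rw [mulVec_mulVec, ← map_mul, mul_inv_cancel, map_one, one_mulVec]

/-- The number of zeros of `quad c`. -/
def zeros (c : Fin 2 ⊕ Fin 2 → ZMod 2) : ℕ := Fintype.card {v // quad c v = 0}

lemma zeros_pull (M : symplecticGroup (Fin 2) ℤ) (c : Fin 2 ⊕ Fin 2 → ZMod 2) :
    zeros (pull M c) = zeros c := by
  refine Fintype.card_congr (Equiv.subtypeEquiv ⟨(red M *ᵥ ·), (red M⁻¹ *ᵥ ·), fun v ↦ ?_,
    red_mulVec_inv M⟩ fun v ↦ by rw [quad_pull]; rfl)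
  simpa using red_mulVec_inv M⁻¹ v

/-- The six quadratic forms of Arf invariant one, on which `Sp(4, ℤ)` acts. -/
abbrev OddForm := {c : Fin 2 ⊕ Fin 2 → ZMod 2 // zeros c = 6}

/-- The action of `Sp(4, ℤ)` on the odd quadratic forms. -/
def formPerm : symplecticGroup (Fin 2) ℤ →* Equiv.Perm OddForm where
  toFun M :=
    { toFun := fun c ↦ ⟨pull M⁻¹ c, (zeros_pull _ _).trans c.2⟩
      invFun := fun c ↦ ⟨pull M c, (zeros_pull _ _).trans c.2⟩
      left_inv := fun c ↦ Subtype.ext (by simp [← pull_mul, pull_one])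
      right_inv := fun c ↦ Subtype.ext (by simp [← pull_mul, pull_one]) }
  map_one' := by ext c : 2; simp [pull_one]
  map_mul' M N := by ext c : 2; simp [pull_mul]

lemma sign_formPerm_plane₁ : Equiv.Perm.sign (formPerm (plane₁ T)) = -1 := by
  decide +kernel

end QuadraticForms

/-- Every element of a commutative quotient of `Sp(4, ℤ)` is a power of the image of a
long root element. -/
lemma map_mem_zpowers_plane₁ {A : Type*} [CommGroup A] (f : symplecticGroup (Fin 2) ℤ →* A)
    (M : symplecticGroup (Fin 2) ℤ) : f M ∈ Subgroup.zpowers (f (plane₁ T)) := by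
  obtain ⟨h₂, h₃, -⟩ := levi_plane_relations f
  refine mem_of_forall_mem (H := (Subgroup.zpowers (f (plane₁ T))).comap f) (fun g ↦ ?_)
    (fun g ↦ ?_) (fun g ↦ ?_) M
  · exact map_mem_zpowers (f.comp plane₁) g
  · exact h₂ ▸ map_mem_zpowers (f.comp plane₂) g
  · exact h₃ ▸ map_mem_zpowers (f.comp levi) g

lemma orderOf_of_plane₁ : orderOf (Abelianization.of (plane₁ T)) = 2 := by
  refine orderOf_eq_prime (levi_plane_relations _).2.2 fun h ↦ ?_
  have h' := congrArg (Abelianization.lift (Equiv.Perm.sign.comp formPerm)) h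
  rw [Abelianization.lift_apply_of, MonoidHom.comp_apply, sign_formPerm_plane₁, map_one] at h'
  exact absurd h' (by decide)

end Sp4

/-- The abelianization of `Sp(4,ℤ)` is isomorphic to `ℤ/2ℤ`; in particular it
has order 2. -/
theorem abelianization_sp4Z :
    Nonempty (Abelianization (Matrix.symplecticGroup (Fin 2) ℤ) ≃*
      Multiplicative (ZMod 2)) ∧
    Nat.card (Abelianization (Matrix.symplecticGroup (Fin 2) ℤ)) = 2 := by
  have hg := Sp4.orderOf_of_plane₁
  have hz : ∀ x, x ∈ Subgroup.zpowers (Abelianization.of (Sp4.plane₁ ModularGroup.T)) := by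
    intro x
    obtain ⟨M, rfl⟩ := QuotientGroup.mk_surjective x
    exact Sp4.map_mem_zpowers_plane₁ Abelianization.of M
  have hc : Nat.card (Abelianization (Matrix.symplecticGroup (Fin 2) ℤ)) = 2 := by
    exact (orderOf_eq_card_of_forall_mem_zpowers hz).symm.trans hg
  exact ⟨⟨mulEquivOfPrimeCardEq (p := 2) hc (by simp)⟩, hc⟩
end
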